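/- For every integer k ≥ 3 and every real c > 0, there exists n₀ ∈ ℕ such that for every finite group Γ with |Γ| ≥ n₀ and every set S ⊆ Γ × Γ with |S| ≥ c·|Γ|², there exists a subset T ⊆ Γ with |T| ≤ min{k + 3, 8√k} such that the number of pairs (a,b) ∈ S with a ∈ T, b ∈ T and a·b ∈ T is at least k. -/

import Mathlib

/-- The number of pairs `(a,b) ∈ S` spanned by `T`, i.e. with `a ∈ T`, `b ∈ T`, `a * b ∈ T`. -/
def spannedCount {Γ : Type} [Group Γ] [DecidableEq Γ] (S : Finset (Γ × Γ)) (T : Finset Γ) : ℕ :=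
  (S.filter (fun p => p.1 ∈ T ∧ p.2 ∈ T ∧ p.1 * p.2 ∈ T)).card

section DensityHalesJewett

open Function Set Combinatorics

/-- The average of a real function on a finite type. -/
noncomputable def avg {X : Type*} [Finite X] (f : X → ℝ) : ℝ :=
  letI := Fintype.ofFinite X
  (∑ x, f x) / Fintype.card X

/-- The density of a subset of a finite type. -/
noncomputable def dens {X : Type*} [Finite X] (s : Set X) : ℝ := avg (s.indicator 1)

section Average

variable {X Y : Type*} [Finite X] [Finite Y]

lemma avg_eq_sum_div [Fintype X] (f : X → ℝ) : avg f = (∑ x, f x) / Fintype.card X := by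
  rw [avg]
  congr!

lemma avg_mono {f g : X → ℝ} (h : ∀ x, f x ≤ g x) : avg f ≤ avg g := by
  have := Fintype.ofFinite X
  simp only [avg_eq_sum_div]
  gcongr with x
  exact h x

lemma avg_add (f g : X → ℝ) : avg (fun x ↦ f x + g x) = avg f + avg g := by
  have := Fintype.ofFinite X
  simp only [avg_eq_sum_div, Finset.sum_add_distrib, add_div]

lemma avg_sub (f g : X → ℝ) : avg (fun x ↦ f x - g x) = avg f - avg g := by
  have := Fintype.ofFinite X
  simp only [avg_eq_sum_div, Finset.sum_sub_distrib, sub_div]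

lemma avg_const_mul (c : ℝ) (f : X → ℝ) : avg (fun x ↦ c * f x) = c * avg f := by
  have := Fintype.ofFinite X
  simp only [avg_eq_sum_div, ← Finset.mul_sum, mul_div_assoc]

lemma avg_const [Nonempty X] (c : ℝ) : avg (fun _ : X ↦ c) = c := by
  have := Fintype.ofFinite X
  simp [avg_eq_sum_div]

lemma avg_comp_equiv (e : X ≃ Y) (f : Y → ℝ) : avg (fun x ↦ f (e x)) = avg f := by
  have := Fintype.ofFinite X
  have := Fintype.ofFinite Y
  simp only [avg_eq_sum_div, e.sum_comp, Fintype.card_congr e]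

lemma avg_prod (f : X × Y → ℝ) : avg f = avg fun x ↦ avg fun y ↦ f (x, y) := by
  have := Fintype.ofFinite X
  have := Fintype.ofFinite Y
  simp only [avg_eq_sum_div, Fintype.sum_prod_type, Fintype.card_prod, ← Finset.sum_div, div_div,
    Nat.cast_mul, mul_comm]

lemma avg_comm (f : X → Y → ℝ) :
    (avg fun x ↦ avg fun y ↦ f x y) = avg fun y ↦ avg fun x ↦ f x y := by
  rw [← avg_prod fun p : X × Y ↦ f p.1 p.2, ← avg_prod fun p : Y × X ↦ f p.2 p.1,
    ← avg_comp_equiv (Equiv.prodComm X Y)]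
  rfl

lemma exists_le_of_le_avg [Nonempty X] {f : X → ℝ} {c : ℝ} (h : c ≤ avg f) : ∃ x, c ≤ f x := by
  by_contra! hf
  have := Fintype.ofFinite X
  have h1 : ∑ x, f x < ∑ _x : X, c :=
    Finset.sum_lt_sum_of_nonempty Finset.univ_nonempty fun x _ ↦ hf x
  rw [avg_eq_sum_div, le_div_iff₀ (by simp [Fintype.card_pos])] at h
  simp at h1
  linarith

lemma avg_nonneg {f : X → ℝ} (h : ∀ x, 0 ≤ f x) : 0 ≤ avg f := by
  have := Fintype.ofFinite X
  rw [avg_eq_sum_div]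
  exact div_nonneg (Finset.sum_nonneg fun x _ ↦ h x) (by positivity)

lemma dens_nonneg (s : Set X) : 0 ≤ dens s :=
  avg_nonneg fun x ↦ indicator_nonneg (fun _ _ ↦ zero_le_one) x

lemma dens_mono {s t : Set X} (h : s ⊆ t) : dens s ≤ dens t :=
  avg_mono fun _ ↦ indicator_le_indicator_of_subset h (fun _ ↦ zero_le_one) _

lemma dens_univ [Nonempty X] : dens (univ : Set X) = 1 := by
  rw [dens, indicator_univ]
  exact avg_const 1

lemma dens_le_one (s : Set X) : dens s ≤ 1 := by
  cases isEmpty_or_nonempty X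
  · have := Fintype.ofFinite X
    simp [dens, avg_eq_sum_div]
  · exact dens_univ (X := X) ▸ dens_mono (subset_univ s)

lemma nonempty_of_dens_pos {s : Set X} (h : 0 < dens s) : s.Nonempty := by
  by_contra! hs
  have := Fintype.ofFinite X
  simp [dens, avg_eq_sum_div, hs] at h

lemma dens_preimage_equiv (e : X ≃ Y) (s : Set Y) : dens (e ⁻¹' s) = dens s :=
  avg_comp_equiv e (s.indicator 1)

lemma dens_eq_ncard_div (s : Set X) : dens s = s.ncard / Nat.card X := by
  classical
  have := Fintype.ofFinite X
  rw [dens, avg_eq_sum_div, Nat.card_eq_fintype_card, Set.ncard_eq_toFinset_card',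
    ← Set.filter_mem_univ_eq_toFinset]
  simp [indicator_apply]

lemma dens_iUnion_le {C : Type*} [Fintype C] (s : C → Set X) :
    dens (⋃ c, s c) ≤ ∑ c, dens (s c) := by
  have := Fintype.ofFinite X
  simp only [dens, avg_eq_sum_div, ← Finset.sum_div]
  rw [Finset.sum_comm]
  gcongr with x
  by_cases hx : x ∈ ⋃ c, s c
  · obtain ⟨c, hc⟩ := mem_iUnion.1 hx
    rw [indicator_of_mem hx]
    calc (1 : X → ℝ) x = (s c).indicator 1 x := by rw [indicator_of_mem hc]
      _ ≤ _ := Finset.single_le_sum (f := fun c ↦ (s c).indicator (1 : X → ℝ) x)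
        (fun c _ ↦ indicator_nonneg (fun _ _ ↦ zero_le_one) x) (Finset.mem_univ c)
  · rw [indicator_of_notMem hx]
    exact Finset.sum_nonneg fun c _ ↦ indicator_nonneg (fun _ _ ↦ zero_le_one) x

/-- Pigeonhole principle for densities. -/
lemma exists_dens_ge_of_subset_iUnion {C : Type*} [Finite C] {s : C → Set X} {t : Set X}
    (hts : t ⊆ ⋃ c, s c) (ht : 0 < dens t) : ∃ c, dens t / Nat.card C ≤ dens (s c) := by
  have := Fintype.ofFinite C
  have h := (dens_mono hts).trans (dens_iUnion_le s)
  obtain ⟨x, hx⟩ := nonempty_of_dens_pos ht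
  obtain ⟨c₀, -⟩ := mem_iUnion.1 (hts hx)
  have : Nonempty C := ⟨c₀⟩
  by_contra! hc
  have h1 : ∑ c, dens (s c) < ∑ _c : C, dens t / Nat.card C :=
    Finset.sum_lt_sum_of_nonempty Finset.univ_nonempty fun x _ ↦ hc x
  have h2 : (0 : ℝ) < Fintype.card C := by exact_mod_cast Fintype.card_pos
  simp only [Nat.card_eq_fintype_card, Finset.sum_const, Finset.card_univ, nsmul_eq_mul] at h1
  rw [mul_div_cancel₀ _ h2.ne'] at h1
  linarith

lemma le_avg_of_forall [Nonempty X] {f : X → ℝ} {c : ℝ} (h : ∀ x, c ≤ f x) : c ≤ avg f :=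
  (avg_const (X := X) c).symm.le.trans (avg_mono h)

lemma avg_le_of_forall [Nonempty X] {f : X → ℝ} {c : ℝ} (h : ∀ x, f x ≤ c) : avg f ≤ c :=
  (avg_mono h).trans (avg_const (X := X) c).le

/-- If `f ≤ 1` has average at least `c + b`, then `f ≥ c` holds with density at least `b`. -/
lemma le_dens_of_add_le_avg [Nonempty X] {f : X → ℝ} {b c : ℝ} (h1 : ∀ x, f x ≤ 1) (hc : 0 ≤ c)
    (h : c + b ≤ avg f) : b ≤ dens {x | c ≤ f x} := by
  have : avg f ≤ avg fun x ↦ c + ({x | c ≤ f x} : Set X).indicator 1 x := by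
    refine avg_mono fun x ↦ ?_
    by_cases hx : c ≤ f x
    · rw [indicator_of_mem (by exact hx)]
      simp only [Pi.one_apply]
      linarith [h1 x]
    · rw [indicator_of_notMem (by exact hx)]
      linarith
  rw [avg_add, avg_const] at this
  change _ ≤ c + dens _ at this
  linarith

lemma avg_dens_comm (s : X → Y → Prop) :
    (avg fun x ↦ dens {y | s x y}) = avg fun y ↦ dens {x | s x y} :=
  avg_comm fun x y ↦ ({y | s x y} : Set Y).indicator 1 y

lemma avg_sumElim {ι κ γ : Type*} [Finite ι] [Finite κ] [Finite γ] (f : (ι ⊕ κ → γ) → ℝ) :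
    avg f = avg fun x : ι → γ ↦ avg fun y : κ → γ ↦ f (Sum.elim x y) := by
  rw [← avg_comp_equiv (Equiv.sumArrowEquivProdArrow ι κ γ).symm, avg_prod]
  rfl

lemma dens_sumElim {ι κ γ : Type*} [Finite ι] [Finite κ] [Finite γ] (s : Set (ι ⊕ κ → γ)) :
    dens s = avg fun x : ι → γ ↦ dens {y : κ → γ | Sum.elim x y ∈ s} :=
  avg_sumElim _

end Average

/-- The density Hales–Jewett property of an alphabet `α`. -/
def DensityHalesJewett (α : Type) [Finite α] : Prop :=
  ∀ δ : ℝ, 0 < δ → ∃ (ι : Type) (_ : Finite ι), ∀ A : Set (ι → α), δ ≤ dens A →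
    ∃ l : Line α ι, ∀ a, l a ∈ A

/-- The density Hales–Jewett property for subspaces of dimension `η`. -/
def MultidimDensityHalesJewett (η α : Type) [Finite α] : Prop :=
  ∀ δ : ℝ, 0 < δ → ∃ (ι : Type) (_ : Finite ι), ∀ A : Set (ι → α), δ ≤ dens A →
    ∃ V : Subspace η α ι, ∀ x, V x ∈ A

section Multidim

variable {η η' α : Type}

lemma MultidimDensityHalesJewett.of_equiv [Finite α] (e : η ≃ η')
    (h : MultidimDensityHalesJewett η α) :
    MultidimDensityHalesJewett η' α := by
  intro δ hδ
  obtain ⟨ι, hι, H⟩ := h δ hδ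
  refine ⟨ι, hι, fun A hA ↦ ?_⟩
  obtain ⟨V, hV⟩ := H A hA
  refine ⟨V.reindex e (Equiv.refl α) (Equiv.refl ι), fun x ↦ ?_⟩
  convert hV (x ∘ e)
  ext i
  simp

/-- The subspace of `ι ⊕ κ → α` spanned by a subspace of `ι → α` and a line of `κ → α`. -/
def Combinatorics.Subspace.sumLine {ι κ : Type} (V : Subspace η α ι) (l : Line α κ) :
    Subspace (Option η) α (ι ⊕ κ) where
  idxFun := Sum.elim (fun i ↦ (V.idxFun i).map id some)
    fun j ↦ (l.idxFun j).elim (.inr none) .inl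
  proper := by
    rintro (_ | e)
    · obtain ⟨j, hj⟩ := l.proper
      exact ⟨.inr j, by simp [hj]⟩
    · obtain ⟨i, hi⟩ := V.proper e
      exact ⟨.inl i, by simp [hi]⟩

lemma Combinatorics.Subspace.sumLine_apply {ι κ : Type} (V : Subspace η α ι) (l : Line α κ)
    (x : Option η → α) : V.sumLine l x = Sum.elim (V (x ∘ some)) (l (x none)) := by
  ext (i | j)
  · cases h : V.idxFun i <;> simp [Subspace.coe_apply, Subspace.sumLine, h]
  · cases h : l.idxFun j <;> simp [Subspace.coe_apply, Subspace.sumLine, h]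

lemma DensityHalesJewett.multidim [Finite α] [Nonempty α] [Finite η] (h : DensityHalesJewett α) :
    MultidimDensityHalesJewett η α := by
  induction η using Finite.induction_empty_option with
  | of_equiv e h => exact h.of_equiv e
  | h_empty =>
    refine fun δ hδ ↦ ⟨Empty, inferInstance, fun A hA ↦ ?_⟩
    obtain ⟨x, hx⟩ := nonempty_of_dens_pos (hδ.trans_le hA)
    exact ⟨⟨Empty.elim, fun e ↦ e.elim⟩, fun y ↦ by rwa [Subsingleton.elim (Subspace.toFun _ y) x]⟩
  | @h_option η _ ih =>
    intro δ hδ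
    obtain ⟨ι, hι, hi⟩ := ih (δ / 2) (by positivity)
    have hC : 0 < Nat.card (ι → α ⊕ η) := Nat.card_pos
    obtain ⟨κ, hκ, hk⟩ := h (δ / 2 / Nat.card (ι → α ⊕ η)) (by positivity)
    refine ⟨ι ⊕ κ, inferInstance, fun A hA ↦ ?_⟩
    set H : Set (κ → α) := {y | δ / 2 ≤ dens {x : ι → α | Sum.elim x y ∈ A}} with hH
    have hHd : δ / 2 ≤ dens H := by
      refine le_dens_of_add_le_avg (fun y ↦ dens_le_one _) (by positivity) ?_
      rw [← avg_dens_comm fun (x : ι → α) (y : κ → α) ↦ Sum.elim x y ∈ A, ← dens_sumElim]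
      linarith
    obtain ⟨g, hg⟩ := exists_dens_ge_of_subset_iUnion (C := ι → α ⊕ η) (t := H)
      (s := fun g ↦ {y | ∃ V : Subspace η α ι, V.idxFun = g ∧ ∀ x, Sum.elim (V x) y ∈ A})
      (fun y hy ↦ by
        obtain ⟨V, hV⟩ := hi _ hy
        exact mem_iUnion.2 ⟨V.idxFun, V, rfl, hV⟩) (by linarith)
    obtain ⟨l, hl⟩ := hk _ (le_trans (by gcongr) hg)
    have hne : Nonempty α := inferInstance
    obtain ⟨V, rfl, -⟩ := hl hne.some
    refine ⟨V.sumLine l, fun x ↦ ?_⟩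
    obtain ⟨W, hW, h⟩ := hl (x none)
    obtain rfl : W = V := Subspace.ext hW
    rw [Subspace.sumLine_apply]
    exact h _

end Multidim

section Insensitive

variable {α : Type}

/-- A set of words over `Option α` is `i`-insensitive if membership is not affected by exchanging
the letters `none` and `some i`. -/
def Insensitive {ν : Type} (i : α) (D : Set (ν → Option α)) : Prop :=
  ∀ x y : ν → Option α, (∀ j, (x j).getD i = (y j).getD i) → x ∈ D → y ∈ D

lemma Insensitive.compl {ν : Type} {i : α} {D : Set (ν → Option α)} (h : Insensitive i D) :
    Insensitive i Dᶜ :=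
  fun x y hxy hx hy ↦ hx (h y x (fun j ↦ (hxy j).symm) hy)

lemma Insensitive.preimage {ν η : Type} {i : α} {D : Set (ν → Option α)} (h : Insensitive i D)
    (V : Subspace η (Option α) ν) : Insensitive i {x | V x ∈ D} := by
  refine fun x y hxy hx ↦ h _ _ (fun j ↦ ?_) hx
  cases hj : V.idxFun j <;> simp [Subspace.coe_apply, hj, hxy]

/-- A position of `s` if there is one. -/
noncomputable def pivot {L : Type} (s : Set L) : Option L :=
  open Classical in if h : s.Nonempty then some h.choose else none

lemma pivot_mem {L : Type} {s : Set L} {l : L} (h : pivot s = some l) : l ∈ s := by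
  rw [pivot] at h
  split_ifs at h with hs
  exact Option.some.inj h ▸ hs.choose_spec

lemma exists_pivot {L : Type} {s : Set L} (h : s.Nonempty) : ∃ l, pivot s = some l :=
  ⟨_, dif_pos h⟩

/-- The pivot of the block `j` of a word, a position of a letter other than `none`. -/
noncomputable def blockPivot {M L : Type} (x : M × L → Option α) (j : M) : Option L :=
  pivot {l | x (j, l) ≠ none}

open Classical in
/-- Replace the letters at the pivots of the blocks by those of `u`. -/
noncomputable def replacePivots {M L : Type} (x : M × L → Option α) (u : M → α) :
    M × L → Option α :=
  fun p ↦ if blockPivot x p.1 = some p.2 then some (u p.1) else x p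

/-- The letters at the pivots of the blocks, with default values taken from `u`. -/
noncomputable def pivotLetters {M L : Type} (x : M × L → Option α) (u : M → α) : M → α :=
  fun j ↦ ((blockPivot x j).bind fun l ↦ x (j, l)).getD (u j)

lemma blockPivot_replacePivots {M L : Type} (x : M × L → Option α) (u : M → α) (j : M) :
    blockPivot (replacePivots x u) j = blockPivot x j := by
  rw [blockPivot, blockPivot]
  congr 1
  ext l
  simp only [replacePivots, mem_ofPred_eq]
  split_ifs with h
  · simpa using pivot_mem h
  · rfl

open Classical in
lemma replacePivots_involutive {M L : Type} : Involutive
    fun p : (M × L → Option α) × (M → α) ↦ (replacePivots p.1 p.2, pivotLetters p.1 p.2) := by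
  rintro ⟨x, u⟩
  refine Prod.ext (funext fun ⟨j, l⟩ ↦ ?_) (funext fun j ↦ ?_)
  · simp only [replacePivots, pivotLetters]
    rw [blockPivot_replacePivots]
    split_ifs with h
    · have := pivot_mem h
      obtain ⟨a, ha⟩ := Option.ne_none_iff_exists'.1 this
      simp [h, ha]
    · rfl
  · simp only [pivotLetters, blockPivot_replacePivots]
    cases h : blockPivot x j with
    | none => simp
    | some l => simp [replacePivots, h]

lemma avg_dens_replacePivots {M L : Type} [Finite M] [Finite L] [Finite α] [Nonempty α]
    (D : Set (M × L → Option α)) :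
    (avg fun x ↦ dens {u : M → α | replacePivots x u ∈ D}) = dens D := by
  have h := avg_comp_equiv (replacePivots_involutive (M := M) (L := L) (α := α)).toPerm
    fun p ↦ D.indicator (1 : (M × L → Option α) → ℝ) p.1
  rw [avg_prod, avg_prod] at h
  refine Eq.trans h ?_
  simp only [avg_const]
  rfl

lemma dens_forall_eq_none_le {M L : Type} [Finite M] [Finite L] [Finite α] (j : M) :
    dens {x : M × L → Option α | ∀ l, x (j, l) = none} =
      ((1 : ℝ) / Nat.card (Option α)) ^ Nat.card L := by
  classical
  have := Fintype.ofFinite M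
  have := Fintype.ofFinite L
  have := Fintype.ofFinite α
  have h : {x : M × L → Option α | ∀ l, x (j, l) = none} =
      ((Fintype.piFinset fun p : M × L ↦ if p.1 = j then {none} else Finset.univ :
        Finset (M × L → Option α)) : Set (M × L → Option α)) := by
    ext x
    simp only [mem_ofPred_eq, Finset.mem_coe, Fintype.mem_piFinset, Prod.forall]
    refine ⟨fun h j' l ↦ ?_, fun h l ↦ by simpa using h j l⟩
    split_ifs with hj
    · subst hj
      simpa using h l
    · simp
  rw [dens_eq_ncard_div, h, Set.ncard_coe_finset, Fintype.card_piFinset, Fintype.prod_prod_type]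
  have hc (i : M) (l : L) : (if (i, l).1 = j then ({none} : Finset (Option α)) else
      Finset.univ).card = if i = j then 1 else Fintype.card (Option α) := by
    split_ifs <;> simp
  obtain ⟨m, hm⟩ : ∃ m, Fintype.card M = m + 1 :=
    ⟨_, (Nat.succ_pred_eq_of_pos (Fintype.card_pos_iff.2 ⟨j⟩)).symm⟩
  simp only [hc, Finset.prod_const, Nat.card_eq_fintype_card, Finset.card_univ, Fintype.card_fun]
  rw [div_pow, div_eq_div_iff (by positivity) (by positivity),
    ← Finset.mul_prod_erase _ _ (Finset.mem_univ j),
    Finset.prod_congr rfl fun i hi ↦ by rw [if_neg (Finset.ne_of_mem_erase hi)],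
    Finset.prod_const, Finset.card_erase_of_mem (Finset.mem_univ j), Finset.card_univ,
    Fintype.card_prod, hm]
  push_cast
  simp
  ring

/-- A dense insensitive set contains a subspace. -/
lemma DensityHalesJewett.exists_subspace_of_insensitive [Finite α] [Nonempty α]
    (h : DensityHalesJewett α) (η : Type) [Finite η] (i : α) {β : ℝ} (hβ : 0 < β) :
    ∃ (ν : Type) (_ : Finite ν), ∀ D : Set (ν → Option α), Insensitive i D → β ≤ dens D →
      ∃ V : Subspace η (Option α) ν, ∀ x, V x ∈ D := by
  classical
  obtain ⟨M, hM, H⟩ := h.multidim (η := η) (β / 2) (by positivity)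
  have := Fintype.ofFinite M
  have := Fintype.ofFinite α
  obtain ⟨n, hn⟩ : ∃ n : ℕ, Nat.card M * ((1 : ℝ) / Nat.card (Option α)) ^ n < β / 2 := by
    obtain ⟨n, hn⟩ := exists_pow_lt_of_lt_one (y := (1 : ℝ) / Nat.card (Option α))
      (x := β / 2 / (Nat.card M + 1)) (by positivity) (by
        have : (0 : ℝ) < Fintype.card α := by exact_mod_cast Fintype.card_pos
        rw [div_lt_one (by exact_mod_cast Nat.card_pos)]
        simpa using this)
    refine ⟨n, ?_⟩
    rw [lt_div_iff₀ (by positivity)] at hn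
    have : 0 ≤ ((1 : ℝ) / Nat.card (Option α)) ^ n := by positivity
    linarith
  refine ⟨M × Fin n, inferInstance, fun D hD hβD ↦ ?_⟩
  set bad : Set (M × Fin n → Option α) := ⋃ j, {x | ∀ l, x (j, l) = none} with hbad
  have hbd : dens bad < β / 2 := by
    refine (dens_iUnion_le _).trans_lt ?_
    simpa [dens_forall_eq_none_le] using hn
  obtain ⟨x, hx⟩ : ∃ x, β / 2 ≤
      dens {u : M → α | replacePivots x u ∈ D} - bad.indicator 1 x := by
    refine exists_le_of_le_avg ?_
    rw [avg_sub, avg_dens_replacePivots]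
    change _ ≤ _ - dens bad
    linarith
  have hxb : x ∉ bad := by
    intro hxb
    rw [indicator_of_mem hxb] at hx
    have := dens_le_one {u : M → α | replacePivots x u ∈ D}
    simp only [Pi.one_apply] at hx
    linarith
  rw [indicator_of_notMem hxb, sub_zero] at hx
  have hpiv (j : M) : ∃ l, blockPivot x j = some l := by
    refine exists_pivot ?_
    by_contra! hj
    refine hxb (mem_iUnion.2 ⟨j, fun l ↦ ?_⟩)
    by_contra hl
    exact (hj ▸ hl : l ∈ (∅ : Set (Fin n)))
  obtain ⟨W, hW⟩ := H _ hx
  refine ⟨⟨fun p ↦ if blockPivot x p.1 = some p.2 then (W.idxFun p.1).map some id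
    else .inl (x p), fun e ↦ ?_⟩, fun z ↦ ?_⟩
  · obtain ⟨j, hj⟩ := W.proper e
    obtain ⟨l, hl⟩ := hpiv j
    exact ⟨(j, l), by simp [hl, hj]⟩
  · refine hD _ _ (fun p ↦ ?_) (hW fun e ↦ (z e).getD i)
    by_cases hp : blockPivot x p.1 = some p.2
    · cases hj : W.idxFun p.1 <;> simp [replacePivots, hp, Subspace.coe_apply, hj]
    · simp [replacePivots, hp, Subspace.coe_apply]

end Insensitive

namespace Combinatorics.Subspace

variable {η ν μ α : Type}

/-- The composition of two combinatorial subspaces. -/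
def comp (W : Subspace ν α μ) (V : Subspace η α ν) : Subspace η α μ where
  idxFun i := (W.idxFun i).elim .inl V.idxFun
  proper e := by
    obtain ⟨j, hj⟩ := V.proper e
    obtain ⟨i, hi⟩ := W.proper j
    exact ⟨i, by simp [hi, hj]⟩

lemma comp_apply (W : Subspace ν α μ) (V : Subspace η α ν) (x : η → α) :
    W.comp V x = W (V x) := by
  ext i
  cases hi : W.idxFun i <;> simp [comp, coe_apply, hi]

/-- A subspace of `μ → α` seen as a subspace of `ν ⊕ μ → α`, with a fixed first part. -/
def prepend (x : ν → α) (V : Subspace η α μ) : Subspace η α (ν ⊕ μ) where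
  idxFun := Sum.elim (fun i ↦ .inl (x i)) V.idxFun
  proper e := (V.proper e).imp' Sum.inr fun i hi ↦ by simpa using hi

lemma prepend_apply (x : ν → α) (V : Subspace η α μ) (z : η → α) :
    prepend x V z = Sum.elim x (V z) := by
  ext (i | i) <;> simp [prepend, coe_apply]

/-- A subspace of `ν → α` seen as a subspace of `ν ⊕ μ → α`, with a fixed second part. -/
def append (V : Subspace η α ν) (y : μ → α) : Subspace η α (ν ⊕ μ) where
  idxFun := Sum.elim V.idxFun (fun i ↦ .inl (y i))
  proper e := (V.proper e).imp' Sum.inl fun i hi ↦ by simpa using hi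

lemma append_apply (V : Subspace η α ν) (y : μ → α) (z : η → α) :
    append V y z = Sum.elim (V z) y := by
  ext (i | i) <;> simp [append, coe_apply]

lemma toFun_injective (V : Subspace η α ν) : Injective V := by
  intro x y h
  ext e
  obtain ⟨i, hi⟩ := V.proper e
  simpa [coe_apply, hi] using congrFun h i

end Combinatorics.Subspace

section Removal

variable {η ν μ α : Type}

lemma avg_indicator_range {X Y : Type*} [Finite X] [Finite Y] [Nonempty X] {v : X → Y}
    (hv : Injective v) (f : Y → ℝ) :
    avg ((range v).indicator f) = dens (range v) * avg fun x ↦ f (v x) := by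
  classical
  have := Fintype.ofFinite X
  have := Fintype.ofFinite Y
  have key (g : Y → ℝ) : ∑ y, (range v).indicator g y = ∑ x, g (v x) := by
    rw [← Finset.sum_image (s := Finset.univ) (g := v) (f := g) hv.injOn]
    rw [Finset.sum_indicator_eq_sum_filter]
    congr 1
    ext
    simp
  have hX : (Fintype.card X : ℝ) ≠ 0 := by positivity
  rw [dens]
  simp only [avg_eq_sum_div, key]
  simp

lemma inv_card_le_dens {X : Type*} [Finite X] {s : Set X} (hs : s.Nonempty) :
    1 / (Nat.card X : ℝ) ≤ dens s := by
  rw [dens_eq_ncard_div]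
  gcongr
  exact_mod_cast (Set.ncard_pos (Set.toFinite s)).2 hs

/-- A subspace contained in `E` if there is one, and the empty set otherwise. -/
noncomputable def containedSubspace (η : Type) {α ν : Type} (E : Set (ν → α)) : Set (ν → α) :=
  open Classical in
  if h : ∃ V : Subspace η α ν, ∀ x, V x ∈ E then range h.choose else ∅

lemma containedSubspace_subset (E : Set (ν → α)) : containedSubspace η E ⊆ E := by
  rw [containedSubspace]
  split_ifs with h
  · rintro _ ⟨x, rfl⟩
    exact h.choose_spec x
  · exact empty_subset _

lemma containedSubspace_nonempty [Nonempty α] {E : Set (ν → α)}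
    (h : ∃ V : Subspace η α ν, ∀ x, V x ∈ E) : (containedSubspace η E).Nonempty := by
  rw [containedSubspace, dif_pos h]
  exact range_nonempty _

lemma avg_indicator_containedSubspace_le [Finite η] [Finite ν] [Finite α] [Nonempty α]
    (E : Set (ν → α)) {f : (ν → α) → ℝ} {c : ℝ}
    (hf : ∀ V : Subspace η α ν, (avg fun x ↦ f (V x)) ≤ c) :
    avg ((containedSubspace η E).indicator f) ≤ c * dens (containedSubspace η E) := by
  rw [containedSubspace]
  split_ifs with h
  · rw [avg_indicator_range h.choose.toFun_injective, mul_comm]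
    exact mul_le_mul_of_nonneg_right (hf _) (dens_nonneg _)
  · simp [dens, avg]

lemma avg_indicator_le_dens {X : Type*} [Finite X] (s : Set X) {f : X → ℝ} (hf : ∀ x, f x ≤ 1) :
    avg (s.indicator f) ≤ dens s :=
  avg_mono fun x ↦ indicator_le_indicator (hf x)

/-- Repeatedly removing subspaces from a family of insensitive sets. -/
lemma DensityHalesJewett.avg_avg_indicator_le [Finite α] [Nonempty α]
    (h : DensityHalesJewett α) (η : Type) [Finite η] (i : α) {β : ℝ} (hβ : 0 < β) :
    ∃ ρ : ℝ, 0 < ρ ∧ ∀ t : ℕ, ∃ (μ : Type) (_ : Finite μ), ∀ (K : Type) [Finite K] [Nonempty K]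
      (D : K → Set (μ → Option α)) (f : K → (μ → Option α) → ℝ) (c : ℝ),
      (∀ κ, Insensitive i (D κ)) → (∀ κ x, f κ x ≤ 1) → 0 ≤ c →
      (∀ κ (V : Subspace η (Option α) μ), (avg fun x ↦ f κ (V x)) ≤ c) →
      (avg fun κ ↦ avg ((D κ).indicator (f κ))) ≤
        c * (avg fun κ ↦ dens (D κ)) + max β ((avg fun κ ↦ dens (D κ)) - t * ρ) := by
  obtain ⟨ν, hν, H⟩ := h.exists_subspace_of_insensitive η i (half_pos hβ)
  have hcard : (0 : ℝ) < Nat.card (ν → Option α) := by exact_mod_cast Nat.card_pos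
  refine ⟨β / 2 * (1 / Nat.card (ν → Option α)), by positivity, fun t ↦ ?_⟩
  set ρ := β / 2 * (1 / (Nat.card (ν → Option α) : ℝ)) with hρ
  induction t with
  | zero =>
    refine ⟨Empty, inferInstance, fun K _ _ D f c _ hf hc _ ↦ ?_⟩
    have h1 : (avg fun κ ↦ avg ((D κ).indicator (f κ))) ≤ avg fun κ ↦ dens (D κ) :=
      avg_mono fun κ ↦ avg_indicator_le_dens _ (hf κ)
    have h2 : 0 ≤ avg fun κ ↦ dens (D κ) := avg_nonneg fun κ ↦ dens_nonneg _
    have h3 := le_max_right β ((avg fun κ ↦ dens (D κ)) - (0 : ℕ) * ρ)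
    have := mul_nonneg hc h2
    push_cast at h3 ⊢
    linarith
  | succ t ih =>
    obtain ⟨μ, hμ, ih⟩ := ih
    refine ⟨ν ⊕ μ, inferInstance, fun K _ _ D f c hD hf hc hV ↦ ?_⟩
    set d := avg fun κ ↦ dens (D κ) with hd
    have hd0 : 0 ≤ d := avg_nonneg fun κ ↦ dens_nonneg _
    rcases le_or_gt d β with hdβ | hdβ
    · have h1 : (avg fun κ ↦ avg ((D κ).indicator (f κ))) ≤ d :=
        avg_mono fun κ ↦ avg_indicator_le_dens _ (hf κ)
      have h3 := le_max_left β (d - (t + 1 : ℕ) * ρ)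
      have := mul_nonneg hc hd0
      linarith
    set sec : K → (μ → Option α) → Set (ν → Option α) := fun κ z ↦ {x | Sum.elim x z ∈ D κ}
    set R : K → (μ → Option α) → Set (ν → Option α) := fun κ z ↦ containedSubspace η (sec κ z)
    have hRD {κ z x} (hx : x ∈ R κ z) : Sum.elim x z ∈ D κ :=
      (containedSubspace_subset (sec κ z) hx : x ∈ sec κ z)
    set D' : K × (ν → Option α) → Set (μ → Option α) :=
      fun p ↦ {z | Sum.elim p.2 z ∈ D p.1 ∧ p.2 ∉ R p.1 z}
    have hsec (κ z z') (hz : ∀ j, (z j : Option α).getD i = (z' j).getD i) :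
        sec κ z = sec κ z' := by
      ext x
      constructor <;> refine hD κ _ _ ?_ <;> rintro (j | j) <;> simp [hz]
    have hsplit (g : K → (ν ⊕ μ → Option α) → ℝ) :
        (avg fun κ ↦ avg ((D κ).indicator (g κ))) =
        (avg fun p : K × (ν → Option α) ↦ avg ((D' p).indicator fun z ↦ g p.1 (Sum.elim p.2 z))) +
        avg fun κ ↦ avg fun z ↦ avg ((R κ z).indicator fun x ↦ g κ (Sum.elim x z)) := by
      rw [avg_prod, ← avg_add]
      congr 1
      ext κ
      rw [avg_comm fun z x ↦ (R κ z).indicator (fun x ↦ g κ (Sum.elim x z)) x, ← avg_add,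
        avg_sumElim]
      congr 1
      ext x
      rw [← avg_add]
      congr 1
      ext z
      by_cases hx : x ∈ R κ z
      · rw [indicator_of_mem hx, indicator_of_mem (hRD hx), indicator_of_notMem (by simp [D', hx]),
          zero_add]
      · rw [indicator_of_notMem hx, add_zero]
        by_cases hxD : Sum.elim x z ∈ D κ
        · rw [indicator_of_mem hxD, indicator_of_mem (by exact ⟨hxD, hx⟩)]
        · rw [indicator_of_notMem hxD, indicator_of_notMem (by exact fun h ↦ hxD h.1)]
    set r := avg fun κ ↦ avg fun z ↦ dens (R κ z) with hr
    have hdr : d = (avg fun p ↦ dens (D' p)) + r := hsplit fun _ ↦ 1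
    have hrem : (avg fun κ ↦ avg fun z ↦ avg ((R κ z).indicator fun x ↦ f κ (Sum.elim x z)))
        ≤ c * r := by
      simp only [hr, ← avg_const_mul]
      refine avg_mono fun κ ↦ avg_mono fun z ↦ avg_indicator_containedSubspace_le _ fun V ↦ ?_
      simpa only [Subspace.append_apply] using hV κ (V.append z)
    have hρr : ρ ≤ r := by
      have h1 : d = avg fun p : K × (μ → Option α) ↦ dens (sec p.1 p.2) := by
        rw [avg_prod, hd]
        congr 1
        ext κ
        rw [dens_sumElim, avg_dens_comm fun (x : ν → Option α) y ↦ Sum.elim x y ∈ D κ]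
      have h2 : β / 2 ≤ dens {p : K × (μ → Option α) | β / 2 ≤ dens (sec p.1 p.2)} :=
        le_dens_of_add_le_avg (fun _ ↦ dens_le_one _) (by positivity) (by linarith)
      have h3 : 1 / (Nat.card (ν → Option α) : ℝ) *
          dens {p : K × (μ → Option α) | β / 2 ≤ dens (sec p.1 p.2)} ≤
          avg fun p : K × (μ → Option α) ↦ dens (R p.1 p.2) := by
        rw [dens, ← avg_const_mul]
        refine avg_mono fun p ↦ ?_
        by_cases hp : β / 2 ≤ dens (sec p.1 p.2)
        · rw [indicator_of_mem (by exact hp), Pi.one_apply, mul_one]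
          refine inv_card_le_dens (containedSubspace_nonempty (H _ (fun x y hxy ↦ ?_) hp))
          refine hD p.1 _ _ ?_
          rintro (j | j) <;> simp [hxy]
        · rw [indicator_of_notMem (by exact hp), mul_zero]
          exact dens_nonneg _
      rw [avg_prod] at h3
      refine le_trans ?_ h3
      rw [hρ, mul_comm]
      gcongr
    have hI := ih (K × (ν → Option α)) D' (fun p z ↦ f p.1 (Sum.elim p.2 z)) c
      (fun p z z' hz ⟨h1, h2⟩ ↦ by
        have := hsec p.1 z z' hz
        refine ⟨?_, ?_⟩
        · change p.2 ∈ sec p.1 z'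
          rw [← this]
          exact h1
        · change p.2 ∉ containedSubspace η (sec p.1 z')
          rw [← this]
          exact h2)
      (fun p z ↦ hf _ _) hc
      (fun p V ↦ by simpa only [Subspace.prepend_apply] using hV p.1 (V.prepend p.2))
    rw [hsplit f]
    have hmax : max β ((avg fun p ↦ dens (D' p)) - t * ρ) ≤ max β (d - (t + 1 : ℕ) * ρ) := by
      refine max_le_max le_rfl ?_
      push_cast
      linarith
    have : c * d = c * (avg fun p ↦ dens (D' p)) + c * r := by rw [hdr, mul_add]
    linarith

/-- A function with small averages on subspaces has small averages on insensitive sets. -/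
lemma DensityHalesJewett.avg_indicator_le_of_insensitive [Finite α] [Nonempty α]
    (h : DensityHalesJewett α) (η : Type) [Finite η] (i : α) {β : ℝ} (hβ : 0 < β) :
    ∃ (μ : Type) (_ : Finite μ), ∀ (D : Set (μ → Option α)) (f : (μ → Option α) → ℝ) (c : ℝ),
      Insensitive i D → (∀ x, f x ≤ 1) → 0 ≤ c →
      (∀ V : Subspace η (Option α) μ, (avg fun x ↦ f (V x)) ≤ c) →
      avg (D.indicator f) ≤ c + β := by
  obtain ⟨ρ, hρ, H⟩ := h.avg_avg_indicator_le η i hβ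
  obtain ⟨t, ht⟩ := exists_nat_gt (1 / ρ)
  obtain ⟨μ, hμ, H⟩ := H t
  refine ⟨μ, hμ, fun D f c hD hf hc hV ↦ ?_⟩
  have := H Unit (fun _ ↦ D) (fun _ ↦ f) c (fun _ ↦ hD) (fun _ ↦ hf) hc (fun _ ↦ hV)
  simp only [avg_const] at this
  have h1 := dens_le_one D
  rw [div_lt_iff₀ hρ] at ht
  rw [max_eq_left (by linarith)] at this
  nlinarith

/-- A function with small averages on subspaces has small averages on complements of intersections
of insensitive sets. -/
lemma DensityHalesJewett.avg_indicator_compl_le_of_insensitive [Finite α] [Nonempty α]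
    (h : DensityHalesJewett α) (η : Type) [Finite η] (s : List α) {β : ℝ} (hβ : 0 < β) :
    ∃ (μ : Type) (_ : Finite μ), ∀ (D : α → Set (μ → Option α)) (f : (μ → Option α) → ℝ),
      (∀ i, Insensitive i (D i)) → (∀ x, f x ≤ 1) →
      (∀ V : Subspace η (Option α) μ, (avg fun x ↦ f (V x)) ≤ 0) →
      avg f ≤ β ∧ avg ({x | ∀ i ∈ s, x ∈ D i}ᶜ.indicator f) ≤ β := by
  induction s generalizing β with
  | nil =>
    refine ⟨η, inferInstance, fun D f hD hf hV ↦ ⟨?_, ?_⟩⟩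
    · exact (hV default).trans hβ.le
    · simpa [avg] using hβ.le
  | cons i s ih =>
    obtain ⟨η', hη', ih⟩ := ih (β := β / 4) (by positivity)
    obtain ⟨μ, hμ, H⟩ := h.avg_indicator_le_of_insensitive η' i (β := β / 4) (by positivity)
    refine ⟨μ, hμ, fun D f hD hf hV ↦ ?_⟩
    have hV' (W : Subspace η' (Option α) μ) := ih (fun i ↦ {x | W x ∈ D i}) (fun x ↦ f (W x))
      (fun i ↦ (hD i).preimage W) (fun x ↦ hf _)
      (fun V ↦ by simpa only [Subspace.comp_apply] using hV (W.comp V))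
    constructor
    · have := H univ f (β / 4) (fun _ _ _ _ ↦ mem_univ _) hf (by positivity) fun W ↦ (hV' W).1
      rw [indicator_univ] at this
      linarith
    · have h1 := H (D i)ᶜ f (β / 4) (hD i).compl hf (by positivity) fun W ↦ (hV' W).1
      have h2 := H (D i) ({x | ∀ i ∈ s, x ∈ D i}ᶜ.indicator f) (β / 4) (hD i)
        (fun x ↦ (indicator_apply_le' (fun _ ↦ hf x) fun _ ↦ zero_le_one)) (by positivity)
        fun W ↦ (hV' W).2
      have h3 : avg ({x | ∀ j ∈ i :: s, x ∈ D j}ᶜ.indicator f) = avg ((D i)ᶜ.indicator f) +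
          avg ((D i).indicator ({x | ∀ i ∈ s, x ∈ D i}ᶜ.indicator f)) := by
        classical
        rw [← avg_add]
        congr 1
        ext x
        by_cases hx : x ∈ D i <;> simp [indicator_apply, hx]
      linarith

end Removal

namespace Combinatorics.Subspace

variable {η ν α ι : Type}

/-- A subspace over `α` seen as a subspace over the larger alphabet `Option α`. -/
def lift (V : Subspace η α ι) : Subspace η (Option α) ι where
  idxFun i := (V.idxFun i).map some id
  proper e := (V.proper e).imp fun i hi ↦ by simp [hi]

lemma lift_apply (V : Subspace η α ι) (w : η → Option α) (i : ι) :
    V.lift w i = (V.idxFun i).elim some w := by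
  cases h : V.idxFun i <;> simp [coe_apply, lift, h]

lemma lift_comp_apply (W : Subspace ν α ι) (V : Subspace η α ν) (w : η → Option α) :
    (W.comp V).lift w = W.lift (V.lift w) := by
  ext1 i
  cases h : W.idxFun i <;> simp [lift_apply, comp, h]

/-- Turn the letter `none` of a subspace over `Option α` into a new dimension, which is also
carried by an additional coordinate. -/
def free (U : Subspace η (Option α) ι) : Subspace (Option η) α (Option ι) where
  idxFun o := o.elim (.inr none) fun i ↦
    (U.idxFun i).elim (fun b ↦ b.elim (.inr none) .inl) fun e ↦ .inr (some e)
  proper := by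
    rintro (_ | e)
    · exact ⟨none, rfl⟩
    · obtain ⟨i, hi⟩ := U.proper e
      exact ⟨some i, by simp [hi]⟩

lemma free_lift_apply (U : Subspace η (Option α) ι) {w : Option η → Option α}
    (hw : w none = none) : U.free.lift w = fun o ↦ o.elim none (U (w ∘ some)) := by
  ext1 o
  cases o with
  | none => simp [lift_apply, free, hw]
  | some i =>
    rw [lift_apply, Option.elim_some, coe_apply]
    cases h : U.idxFun i with
    | inl b => cases b <;> simp [free, h, hw]
    | inr e => simp [free, h]

/-- Add a dimension and a coordinate to a subspace. -/
def addCoord (V : Subspace η α ι) : Subspace (Option η) α (Option ι) where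
  idxFun o := o.elim (.inr none) fun i ↦ (V.idxFun i).map id some
  proper := by
    rintro (_ | e)
    · exact ⟨none, rfl⟩
    · obtain ⟨i, hi⟩ := V.proper e
      exact ⟨some i, by simp [hi]⟩

lemma addCoord_lift_apply (V : Subspace η α ι) (w : Option η → Option α) :
    V.addCoord.lift w = fun o ↦ o.elim (w none) (V.lift (w ∘ some)) := by
  ext1 o
  cases o with
  | none => simp [lift_apply, addCoord]
  | some i => cases h : V.idxFun i <;> simp [lift_apply, addCoord, h]

/-- The subspace where an additional coordinate is constant. -/
def constCoord (ι : Type) (a : α) : Subspace ι α (Option ι) where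
  idxFun o := o.elim (.inl a) .inr
  proper e := ⟨some e, rfl⟩

lemma constCoord_lift_apply (a : α) (w : ι → Option α) :
    (constCoord ι a).lift w = fun o ↦ o.elim (some a) w := by
  ext1 o
  cases o <;> simp [lift_apply, constCoord]

/-- The subspace where the coordinates in `ν` are constant. -/
def constLeft (ν ι : Type) (a : α) : Subspace (Option ι) α (Option (ν ⊕ ι)) where
  idxFun o := o.elim (.inr none) (Sum.elim (fun _ ↦ .inl a) fun i ↦ .inr (some i))
  proper := by
    rintro (_ | e)
    · exact ⟨none, rfl⟩
    · exact ⟨some (.inr e), rfl⟩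

end Combinatorics.Subspace

/-- Either the good words over `α` with a variable `none` contain a large subspace of words, or
they are disjoint from a large subspace. -/
lemma exists_subspace_good_or_bad (α μ : Type) [Finite α] [Nonempty α] [Finite μ] (η : Type)
    [Finite η] : ∀ (β : Type) [Finite β], ∃ (ι : Type) (_ : Finite ι),
    ∀ G : β → Set (ι → Option α),
      (∃ b, ∃ V : Subspace (Option μ) α ι, ∀ w, w none = none → V.lift w ∈ G b) ∨
      ∃ V : Subspace η α ι, ∀ w, (∃ j, w j = none) → ∀ b, V.lift w ∉ G b := by
  induction η using Finite.induction_empty_option with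
  | @of_equiv η η' e h =>
    intro β _
    obtain ⟨ι, hι, H⟩ := h β
    refine ⟨ι, hι, fun G ↦ (H G).imp_right ?_⟩
    rintro ⟨V, hV⟩
    refine ⟨V.reindex e (Equiv.refl α) (Equiv.refl ι), fun w ⟨j, hj⟩ b ↦ ?_⟩
    convert hV (w ∘ e) ⟨e.symm j, by simpa using hj⟩ b using 2
    ext1 i
    cases h : V.idxFun i <;> simp [Subspace.lift_apply, Subspace.reindex, h]
  | h_empty =>
    exact fun β _ ↦ ⟨Empty, inferInstance, fun G ↦ .inr
      ⟨⟨Empty.elim, fun e ↦ e.elim⟩, fun w ⟨j, _⟩ ↦ j.elim⟩⟩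
  | @h_option η _ ih =>
    intro β _
    have a₀ : α := Classical.arbitrary α
    obtain ⟨κ, hκ, ih⟩ := ih (β × α)
    obtain ⟨ι, hι, H⟩ := Subspace.exists_mono_in_high_dimension (Option α) (β → Prop) (κ ⊕ μ)
    refine ⟨Option ι, inferInstance, fun G ↦ ?_⟩
    obtain ⟨U, c, hU⟩ := H fun u b ↦ (fun o : Option ι ↦ o.elim none u) ∈ G b
    have hU (w) (hw : w none = none) (b) : U.free.lift w ∈ G b ↔ c b := by
      rw [U.free_lift_apply hw, ← hU (w ∘ some)]
    by_cases hc : ∃ b, c b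
    · obtain ⟨b, hb⟩ := hc
      refine .inl ⟨b, U.free.comp (.constLeft κ μ a₀), fun w hw ↦ ?_⟩
      rw [Subspace.lift_comp_apply, hU _ _ b]
      · exact hb
      · simpa [Subspace.lift_apply, Subspace.constLeft]
    · push Not at hc
      let s : Subspace κ α (κ ⊕ μ) :=
        ⟨Sum.elim .inr fun _ ↦ .inl a₀, fun e ↦ ⟨.inl e, rfl⟩⟩
      set W := U.free.comp s.addCoord with hW
      rcases ih fun p ↦ {z | (W.comp (.constCoord κ p.2)).lift z ∈ G p.1} with
        ⟨⟨b, a⟩, V, hV⟩ | ⟨V, hV⟩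
      · refine .inl ⟨b, (W.comp (.constCoord κ a)).comp V, fun w hw ↦ ?_⟩
        rw [Subspace.lift_comp_apply]
        exact hV w hw
      · refine .inr ⟨W.comp V.addCoord, fun w ⟨j, hj⟩ b hb ↦ ?_⟩
        rw [Subspace.lift_comp_apply, Subspace.addCoord_lift_apply] at hb
        cases hn : w none with
        | none =>
          rw [hW, Subspace.lift_comp_apply, hU _ _ b] at hb
          · exact hc b hb
          · simp [Subspace.addCoord_lift_apply, hn]
        | some a =>
          obtain _ | j := j
          · simp [hn] at hj
          refine hV (w ∘ some) ⟨j, hj⟩ (b, a) ?_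
          simpa [Subspace.lift_comp_apply, Subspace.constCoord_lift_apply, hn] using hb

/-- The line of `μ → α` which corresponds to a line of a subspace. -/
def Combinatorics.Subspace.compLine {η μ α : Type} (W : Subspace η α μ) (l : Line α η) :
    Line α μ where
  idxFun j := (W.idxFun j).elim some l.idxFun
  proper := by
    obtain ⟨e, he⟩ := l.proper
    obtain ⟨j, hj⟩ := W.proper e
    exact ⟨j, by simp [hj, he]⟩

lemma Combinatorics.Subspace.compLine_apply {η μ α : Type} (W : Subspace η α μ) (l : Line α η)
    (a : α) : W.compLine l a = W (l a) := by
  ext j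
  cases hj : W.idxFun j <;> simp [compLine, Line.coe_apply, coe_apply, hj]

lemma sub_card_mul_le_of_le_avg {X : Type*} [Finite X] {f : X → ℝ} {b ε : ℝ} (hf : ∀ x, f x ≤ b)
    (h : b - ε ≤ avg f) (x : X) : b - Nat.card X * ε ≤ f x := by
  classical
  have := Fintype.ofFinite X
  have hX : (0 : ℝ) < Fintype.card X := by exact_mod_cast Fintype.card_pos_iff.2 ⟨x⟩
  rw [avg_eq_sum_div, le_div_iff₀ hX] at h
  have h1 : ∑ y, (b - f y) ≥ b - f x :=
    Finset.single_le_sum (f := fun y ↦ b - f y) (fun y _ ↦ sub_nonneg.2 (hf y)) (Finset.mem_univ x)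
  rw [Finset.sum_sub_distrib, Finset.sum_const, nsmul_eq_mul, Finset.card_univ] at h1
  rw [Nat.card_eq_fintype_card]
  linarith

section Increment

variable {α ι κ : Type} [Finite α] [Finite κ]

/-- If a set without lines has all its fibres of almost maximal density, then a subspace of words
`w` such that few fibres contain `w` with a letter of `α` in place of the variable exists. -/
lemma DensityHalesJewett.exists_line_good {M : Type} [Finite M] {δ : ℝ} (hδ : 0 < δ)
    (hM : ∀ A : Set (M → α), δ / 4 ≤ dens A → ∃ l : Line α M, ∀ a, l a ∈ A)
    {A : Set (ι ⊕ κ → Option α)} (hA : ∀ w, δ / 2 ≤ dens {y : κ → Option α | Sum.elim w y ∈ A})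
    [Nonempty α] (V : Subspace M α ι) :
    ∃ w : M → Option α, (∃ j, w j = none) ∧ δ / 4 / Nat.card (M → Option α) ≤
      dens {y : κ → Option α | ∀ i, Sum.elim (fun j ↦ some ((V.lift w j).getD i)) y ∈ A} := by
  set B : (κ → Option α) → Set (M → α) :=
    fun y ↦ {u | Sum.elim (V.lift (some ∘ u)) y ∈ A}
  have h1 : δ / 4 ≤ dens {y | δ / 4 ≤ dens (B y)} := by
    refine le_dens_of_add_le_avg (fun _ ↦ dens_le_one _) (by positivity) ?_
    rw [← avg_dens_comm fun (u : M → α) (y : κ → Option α) ↦ Sum.elim (V.lift (some ∘ u)) y ∈ A]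
    refine le_trans (by linarith) (le_avg_of_forall fun u ↦ hA _)
  obtain ⟨g, hg⟩ := exists_dens_ge_of_subset_iUnion
    (t := {y | δ / 4 ≤ dens (B y)})
    (s := fun g ↦ {y | ∃ l : Line α M, l.idxFun = g ∧ ∀ a, l a ∈ B y})
    (fun y hy ↦ by
      obtain ⟨l, hl⟩ := hM _ hy
      exact mem_iUnion.2 ⟨l.idxFun, l, rfl, hl⟩) (lt_of_lt_of_le (by positivity) h1)
  have hg' : δ / 4 / Nat.card (M → Option α) ≤ _ := le_trans (by gcongr) hg
  obtain ⟨y, l, rfl, -⟩ := nonempty_of_dens_pos (lt_of_lt_of_le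
    (div_pos (by positivity) (by exact_mod_cast Nat.card_pos)) hg')
  refine ⟨l.idxFun, l.proper, hg'.trans (dens_mono ?_)⟩
  rintro y ⟨l', hl, hy⟩ i
  have h : (fun j ↦ some ((V.lift l.idxFun j).getD i)) = V.lift (some ∘ l' i) := by
    ext1 j
    cases hj : V.idxFun j <;> simp [Subspace.lift_apply, hj, Line.coe_apply, hl]
  rw [h]
  exact hy i

end Increment

section Step

variable {α : Type} [Finite α]

/-- If the density Hales–Jewett theorem holds above the density `δ`, then it also holds
somewhat below. -/
lemma DensityHalesJewett.exists_increment [Nonempty α] (h : DensityHalesJewett α) {δ : ℝ}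
    (hδ : 0 < δ)
    (H : ∀ ε : ℝ, 0 < ε → ∃ (ι : Type) (_ : Finite ι), ∀ A : Set (ι → Option α),
      δ + ε ≤ dens A → ∃ l : Line (Option α) ι, ∀ a, l a ∈ A) :
    ∃ ε : ℝ, 0 < ε ∧ ∃ (ι : Type) (_ : Finite ι), ∀ A : Set (ι → Option α),
      δ - ε ≤ dens A → ∃ l : Line (Option α) ι, ∀ a, l a ∈ A := by
  have := Fintype.ofFinite α
  obtain ⟨M, hM, HM⟩ := h (δ / 4) (by positivity)
  set θ : ℝ := δ / 4 / Nat.card (M → Option α) with hθ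
  have hθ0 : 0 < θ := div_pos (by positivity) (by exact_mod_cast Nat.card_pos)
  set κ : ℝ := min (δ * θ / 4) (δ / 4) with hκ
  have hκ0 : 0 < κ := by positivity
  have hκ1 : κ ≤ δ * θ / 4 := min_le_left _ _
  have hκ2 : κ ≤ δ / 4 := min_le_right _ _
  obtain ⟨η, hη, Hη⟩ := H κ hκ0
  obtain ⟨μ, hμ, Hμ⟩ := h.avg_indicator_compl_le_of_insensitive η Finset.univ.toList hκ0
  obtain ⟨ι, hι, Hι⟩ := exists_subspace_good_or_bad α μ M Unit
  have hN : (0 : ℝ) < Nat.card (ι → Option α) := by exact_mod_cast Nat.card_pos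
  set ε : ℝ := κ / (2 * Nat.card (ι → Option α)) with hε
  have hε0 : 0 < ε := by positivity
  obtain ⟨Y, hY, HY⟩ := H ε hε0
  refine ⟨ε, hε0, ι ⊕ Y, inferInstance, fun A hA ↦ ?_⟩
  by_contra hl
  have hfib (w : ι → Option α) : δ - κ ≤ dens {y : Y → Option α | Sum.elim w y ∈ A} := by
    have h1 (w : ι → Option α) : dens {y : Y → Option α | Sum.elim w y ∈ A} ≤ δ + ε := by
      by_contra! hw
      obtain ⟨l, hlA⟩ := HY _ hw.le
      refine hl ⟨(Subspace.prepend w default).compLine l, fun a ↦ ?_⟩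
      rw [Subspace.compLine_apply, Subspace.prepend_apply]
      exact hlA a
    rw [dens_sumElim] at hA
    have h2 := sub_card_mul_le_of_le_avg (ε := 2 * ε) h1 (by linarith) w
    have h3 : Nat.card (ι → Option α) * (2 * ε) = κ := by
      rw [hε]
      field_simp
    linarith
  obtain ⟨_, V, hV⟩ | ⟨V, hV⟩ := Hι fun _ ↦ {w | θ ≤ dens {y : Y → Option α |
    ∀ i, Sum.elim (fun j ↦ some ((w j).getD i)) y ∈ A}}
  swap
  · obtain ⟨w, hw, hwA⟩ := DensityHalesJewett.exists_line_good hδ HM (A := A)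
      (fun w ↦ by linarith [hfib w]) V
    exact hV w hw () hwA
  set P : Subspace μ (Option α) ι := V.lift.comp (.constCoord μ none) with hP
  have hPV (w) : P w = V.lift fun o ↦ o.elim none w := by
    rw [hP, Subspace.comp_apply]
    congr 1
    ext1 o
    cases o <;> simp [Subspace.coe_apply, Subspace.constCoord]
  have hPnone (w) : ∃ j, P w j = none := by
    obtain ⟨j, hj⟩ := V.proper none
    exact ⟨j, by simp [hPV, Subspace.lift_apply, hj]⟩
  set A' : (Y → Option α) → Set (μ → Option α) := fun y ↦ {w | Sum.elim (P w) y ∈ A}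
  set D : (Y → Option α) → α → Set (μ → Option α) :=
    fun y i ↦ {w | Sum.elim (fun j ↦ some ((P w j).getD i)) y ∈ A}
  set E : (Y → Option α) → Set (μ → Option α) := fun y ↦ {w | ∀ i, w ∈ D y i}
  have hD (y i) : Insensitive i (D y i) := by
    intro w w' hw hwD
    have : (fun j ↦ some ((P w j).getD i)) = fun j ↦ some ((P w' j).getD i) := by
      ext1 j
      cases hj : P.idxFun j <;> simp [Subspace.coe_apply, hj, hw]
    change Sum.elim (fun j ↦ some ((P w' j).getD i)) y ∈ A
    rw [← this]
    exact hwD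
  have hdisj (y w) (hw : w ∈ A' y) : w ∉ E y := by
    intro hwE
    refine hl ⟨⟨Sum.elim (fun j ↦ (P w j).map some) (some ∘ y), ?_⟩, ?_⟩
    · obtain ⟨j, hj⟩ := hPnone w
      exact ⟨.inl j, by simp [hj]⟩
    · rintro (_ | i)
      · refine (congrArg (· ∈ A) ?_).mpr (hw)
        ext1 (j | j)
        · cases hj : P w j <;> simp [Line.coe_apply, hj]
        · simp [Line.coe_apply]
      · refine (congrArg (· ∈ A) ?_).mpr (hwE i)
        ext1 (j | j)
        · cases hj : P w j <;> simp [Line.coe_apply, hj]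
        · simp [Line.coe_apply]
  have hmain (y) : dens (A' y) + (δ + κ) * dens (E y) ≤ δ + 2 * κ := by
    have h1 := (Hμ (D y) (fun w ↦ (A' y).indicator 1 w - (δ + κ)) (hD y) (fun w ↦ by
      have : (A' y).indicator (1 : (μ → Option α) → ℝ) w ≤ 1 :=
        indicator_apply_le' (fun _ ↦ le_rfl) fun _ ↦ zero_le_one
      linarith) (fun W ↦ by
      rw [avg_sub, avg_const, sub_nonpos]
      by_contra! hW
      obtain ⟨l, hlA⟩ := Hη {z | W z ∈ A' y} hW.le
      refine hl ⟨((P.append y).comp W).compLine l, fun a ↦ ?_⟩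
      rw [Subspace.compLine_apply, Subspace.comp_apply, Subspace.append_apply]
      exact hlA a)).2
    have hE : {x | ∀ i ∈ Finset.univ.toList, x ∈ D y i} = E y := by simp [E]
    rw [hE] at h1
    have h2 : dens (A' y) + (δ + κ) * dens (E y) - (δ + κ) =
        avg ((E y)ᶜ.indicator
          fun w ↦ (A' y).indicator 1 w - (δ + κ)) := by
      rw [dens, dens, ← avg_const_mul, ← avg_add,
        ← avg_const (X := μ → Option α) (δ + κ), ← avg_sub, avg_const]
      congr 1
      ext w
      classical
      by_cases hw : w ∈ E y
      · have hwA : w ∉ A' y := fun h ↦ hdisj y w h hw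
        simp [indicator_apply, hwA, hw]
      · simp [indicator_apply, hw]
    linarith
  have hA' : δ - κ ≤ avg fun y ↦ dens (A' y) := by
    rw [← avg_dens_comm fun w (y : Y → Option α) ↦ Sum.elim (P w) y ∈ A]
    exact le_avg_of_forall fun w ↦ hfib _
  have hE : θ ≤ avg fun y ↦ dens (E y) := by
    refine le_trans ?_ (avg_dens_comm fun w (y : Y → Option α) ↦
      ∀ i, Sum.elim (fun j ↦ some ((P w j).getD i)) y ∈ A).le
    refine le_avg_of_forall fun w ↦ ?_
    simp only [hPV]
    exact hV _ rfl
  have := avg_le_of_forall hmain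
  rw [avg_add, avg_const_mul] at this
  have : (δ + κ) * θ ≤ (δ + κ) * avg fun y ↦ dens (E y) := by gcongr
  nlinarith

lemma DensityHalesJewett.option [Nonempty α] (h : DensityHalesJewett α) :
    DensityHalesJewett (Option α) := by
  by_contra hn
  simp only [DensityHalesJewett, not_forall] at hn
  obtain ⟨δ₀, hδ₀, hn⟩ := hn
  set s : Set ℝ := {δ | ∃ (ι : Type) (_ : Finite ι), ∀ A : Set (ι → Option α), δ ≤ dens A →
    ∃ l : Line (Option α) ι, ∀ a, l a ∈ A} with hs
  have hup {δ δ' : ℝ} (hd : δ ≤ δ') (hδ : δ ∈ s) : δ' ∈ s := by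
    obtain ⟨ι, hι, H⟩ := hδ
    exact ⟨ι, hι, fun A hA ↦ H A (hd.trans hA)⟩
  have hlb : δ₀ ∈ lowerBounds s := fun δ hδ ↦ by
    by_contra! hlt
    exact hn (hup hlt.le hδ)
  have hne : s.Nonempty :=
    ⟨2, Unit, inferInstance, fun A hA ↦ absurd (dens_le_one A) (by linarith)⟩
  have hδ : 0 < sInf s := hδ₀.trans_le (le_csInf hne hlb)
  obtain ⟨ε, hε, hs'⟩ := h.exists_increment hδ fun ε hε ↦ by
    obtain ⟨δ, hδs, hlt⟩ := exists_lt_of_csInf_lt hne (lt_add_of_pos_right (sInf s) hε)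
    exact hup hlt.le hδs
  have := csInf_le ⟨δ₀, hlb⟩ (show sInf s - ε ∈ s from hs')
  linarith

lemma DensityHalesJewett.of_equiv {β : Type} [Finite β] (e : α ≃ β) (h : DensityHalesJewett α) :
    DensityHalesJewett β := by
  intro δ hδ
  obtain ⟨ι, hι, H⟩ := h δ hδ
  refine ⟨ι, hι, fun A hA ↦ ?_⟩
  obtain ⟨l, hl⟩ := H ((Equiv.arrowCongr (Equiv.refl ι) e) ⁻¹' A)
    (by rwa [dens_preimage_equiv])
  refine ⟨l.map e, fun b ↦ ?_⟩
  have := hl (e.symm b)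
  rw [← e.apply_symm_apply b, Line.map_apply]
  exact this

lemma densityHalesJewett_of_subsingleton [Subsingleton α] : DensityHalesJewett α := by
  refine fun δ hδ ↦ ⟨Unit, inferInstance, fun A hA ↦ ?_⟩
  obtain ⟨x, hx⟩ := nonempty_of_dens_pos (hδ.trans_le hA)
  exact ⟨default, fun a ↦ by rwa [Subsingleton.elim (Line.toFun _ a) x]⟩

/-- The density Hales–Jewett theorem. -/
theorem densityHalesJewett (α : Type) [Finite α] : DensityHalesJewett α := by
  refine Finite.induction_empty_option (P := fun α ↦ ∀ [Finite α], DensityHalesJewett α)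
    (fun {α β} e h _ ↦ ?_) densityHalesJewett_of_subsingleton (fun {α} _ h _ ↦ ?_) α
  · have := Finite.of_equiv β e.symm
    exact h.of_equiv e
  · cases isEmpty_or_nonempty α
    · exact densityHalesJewett_of_subsingleton
    · exact h.option

end Step

end DensityHalesJewett

section AbelianSubgroup

variable {G : Type} [Group G] [Finite G]

open Subgroup in
/-- A self-centralizing normal abelian subgroup of a finite `p`-group. -/
lemma IsPGroup.exists_normal_centralizer_le {p : ℕ} [hp : Fact p.Prime] (hG : IsPGroup p G) :
    ∃ A : Subgroup G, A.Normal ∧ (∀ a ∈ A, ∀ b ∈ A, a * b = b * a) ∧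
      centralizer (A : Set G) ≤ A := by
  obtain ⟨A, ⟨hA, hc⟩, hmax⟩ := Set.Finite.exists_maximal
    (s := {A : Subgroup G | A.Normal ∧ ∀ a ∈ A, ∀ b ∈ A, a * b = b * a}) (Set.toFinite _)
    ⟨⊥, inferInstance, by simp⟩
  refine ⟨A, hA, hc, ?_⟩
  by_contra hn
  set N : Subgroup (G ⧸ A) := (centralizer (A : Set G)).map (QuotientGroup.mk' A) with hN
  have hNn : N.Normal := Normal.map inferInstance _ (QuotientGroup.mk'_surjective A)
  have hQ : IsPGroup p (ConjAct (G ⧸ A)) :=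
    (hG.to_quotient A).of_equiv ConjAct.toConjAct
  have hN1 : Nat.card N ≠ 1 := by
    rw [ne_eq, card_eq_one, hN, Subgroup.map_eq_bot_iff, QuotientGroup.ker_mk']
    exact hn
  have hpN : p ∣ Nat.card N :=
    (((hG.to_quotient A).to_subgroup N).card_eq_or_dvd).resolve_left hN1
  obtain ⟨z', hz', hne⟩ := hQ.exists_fixed_point_of_prime_dvd_card_of_fixed_point N hpN
    (a := 1) (fun g ↦ smul_one g)
  obtain ⟨z, hzC, hz⟩ := mem_map.1 z'.2
  have hcen (g : G ⧸ A) : g * z' = z' * g := by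
    have := congrArg Subtype.val (hz' (ConjAct.toConjAct g))
    rw [ConjAct.Subgroup.val_conj_smul, ConjAct.toConjAct_smul] at this
    exact mul_inv_eq_iff_eq_mul.1 this
  set B : Subgroup G := (zpowers (z' : G ⧸ A)).comap (QuotientGroup.mk' A) with hB
  have hAB : A ≤ B := fun a ha ↦ by
    rw [hB, mem_comap, QuotientGroup.mk'_apply, (QuotientGroup.eq_one_iff a).2 ha]
    exact one_mem _
  have hBn : B.Normal := by
    have : (zpowers (z' : G ⧸ A)).Normal := by
      refine ⟨?_⟩
      rintro _ ⟨n, rfl⟩ g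
      have : Commute g (z' : G ⧸ A) := hcen g
      rw [(this.zpow_right n).eq, mul_inv_cancel_right]
      exact ⟨n, rfl⟩
    exact Normal.comap this _
  have hrep (b) (hb : b ∈ B) : ∃ n : ℤ, ∃ a ∈ A, b = z ^ n * a := by
    obtain ⟨n, hn⟩ := hb
    refine ⟨n, (z ^ n)⁻¹ * b, ?_, by group⟩
    rw [← QuotientGroup.eq]
    simpa [← hz] using hn
  have hza (a) (ha : a ∈ A) : Commute a z := mem_centralizer_iff.1 hzC a ha
  have hBc : ∀ a ∈ B, ∀ b ∈ B, a * b = b * a := by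
    intro a ha b hb
    obtain ⟨n, a, haA, rfl⟩ := hrep a ha
    obtain ⟨m, b, hbA, rfl⟩ := hrep b hb
    have h1 : Commute (z ^ n) (z ^ m * b) :=
      ((Commute.refl z).zpow_zpow n m).mul_right ((hza b hbA).symm.zpow_left n)
    have h2 : Commute a (z ^ m * b) := ((hza a haA).zpow_right m).mul_right (hc a haA b hbA)
    exact h1.mul_left h2
  have hzA : z ∈ A := hmax ⟨hBn, hBc⟩ hAB (by
    rw [hB, mem_comap, hz]
    exact mem_zpowers _)
  refine hne (Subtype.ext ?_)
  rw [← hz, coe_one, QuotientGroup.mk'_apply, (QuotientGroup.eq_one_iff z).2 hzA]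

lemma Subgroup.card_le_of_centralizer_le {A : Subgroup G} [A.Normal]
    (h : centralizer (A : Set G) ≤ A) : Nat.card G ≤ Nat.card A * Nat.card A ^ Nat.card A := by
  have hker : (MulAut.conjNormal : G →* MulAut A).ker ≤ A := by
    refine le_trans (fun g hg ↦ ?_) h
    rw [mem_centralizer_iff]
    intro a ha
    have := congrArg Subtype.val (DFunLike.congr_fun (MonoidHom.mem_ker.1 hg) ⟨a, ha⟩)
    rw [MulAut.conjNormal_apply] at this
    exact (mul_inv_eq_iff_eq_mul.1 this).symm
  rw [← card_mul_index A]
  gcongr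
  calc A.index ≤ (MulAut.conjNormal : G →* MulAut A).ker.index :=
        Nat.le_of_dvd (Nat.pos_of_ne_zero index_ne_zero_of_finite) (index_dvd_of_le hker)
    _ = Nat.card (MulAut.conjNormal : G →* MulAut A).range := index_ker _
    _ ≤ Nat.card (A → A) := by
        refine Nat.card_le_card_of_injective (fun f a ↦ f.1 a) fun f g hfg ↦ ?_
        exact Subtype.ext (MulEquiv.ext (congrFun hfg))
    _ = _ := Nat.card_fun

/-- Large finite groups have large abelian subgroups. -/
lemma exists_le_card_abelian_subgroup (K : ℕ) : ∃ n₀ : ℕ, ∀ (Γ : Type) [Group Γ] [Finite Γ],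
    n₀ ≤ Nat.card Γ → ∃ A : Subgroup Γ, IsMulCommutative A ∧ K < Nat.card A := by
  refine ⟨(K * K ^ K).factorial + 1, fun Γ _ _ hΓ ↦ ?_⟩
  set m := K * K ^ K
  have hdvd : ¬ Nat.card Γ ∣ m.factorial := fun h ↦ by
    have := Nat.le_of_dvd (Nat.factorial_pos _) h
    omega
  rw [Nat.dvd_iff_prime_pow_dvd_dvd] at hdvd
  push Not at hdvd
  obtain ⟨p, v, hp, hpv, hm⟩ := hdvd
  have := Fact.mk hp
  obtain ⟨P, hP⟩ := Sylow.exists_subgroup_card_pow_prime p hpv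
  have hmP : m < Nat.card P := by
    rw [hP]
    by_contra! hle
    exact hm (Nat.dvd_factorial (pow_pos hp.pos v) hle)
  obtain ⟨A, hA, hc, hcen⟩ := (IsPGroup.of_card hP).exists_normal_centralizer_le
  refine ⟨A.map P.subtype, ⟨⟨?_⟩⟩, ?_⟩
  · rintro ⟨_, a, ha, rfl⟩ ⟨_, b, hb, rfl⟩
    refine Subtype.ext ?_
    simpa using congrArg Subtype.val (hc a ha b hb)
  · rw [Subgroup.card_map_of_injective P.subtype_injective]
    by_contra! hle
    have := Subgroup.card_le_of_centralizer_le hcen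
    have h2 : Nat.card A * Nat.card A ^ Nat.card A ≤ K * K ^ K := by
      have : 0 < Nat.card A := Nat.card_pos
      gcongr
      exact this.trans_le hle
    omega

end AbelianSubgroup

section Grids

open Function Set Combinatorics

section Digits

lemma exists_digitwise_add (q : ℕ) [NeZero q] (s i j : ℕ) :
    ∃ l ≤ i + j, ∀ r < s, ((i / q ^ r : ℕ) : ZMod q) + (j / q ^ r : ℕ) = (l / q ^ r : ℕ) := by
  have hq : 0 < q := NeZero.pos q
  induction s generalizing i j with
  | zero => exact ⟨0, by simp, by simp⟩
  | succ s ih =>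
    obtain ⟨l, hl, h⟩ := ih (i / q) (j / q)
    refine ⟨q * l + (i + j) % q, ?_, ?_⟩
    · have h1 := Nat.mul_le_mul_left q hl
      have h2 := Nat.div_add_mod i q
      have h3 := Nat.div_add_mod j q
      have h4 : (i + j) % q ≤ i % q + j % q := by
        rw [Nat.add_mod]
        exact Nat.mod_le _ _
      rw [mul_add] at h1
      omega
    · rintro (_ | r) hr
      · simp
      · simp only [pow_succ', ← Nat.div_div_eq_div_mul]
        rw [h r (by omega), Nat.mul_add_div hq, Nat.div_eq_of_lt (Nat.mod_lt _ hq), add_zero]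

lemma eq_of_digits_eq (q : ℕ) (s i j : ℕ) (hi : i < q ^ s) (hj : j < q ^ s)
    (h : ∀ r < s, ((i / q ^ r : ℕ) : ZMod q) = (j / q ^ r : ℕ)) : i = j := by
  induction s generalizing i j with
  | zero =>
    rw [pow_zero] at hi hj
    omega
  | succ s ih =>
    have h0 := h 0 (by omega)
    rw [pow_zero, Nat.div_one, Nat.div_one, ZMod.natCast_eq_natCast_iff'] at h0
    have h1 := ih (i / q) (j / q) (Nat.div_lt_of_lt_mul (by rwa [← pow_succ']))
      (Nat.div_lt_of_lt_mul (by rwa [← pow_succ'])) fun r hr ↦ by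
        simpa only [pow_succ', ← Nat.div_div_eq_div_mul] using h (r + 1) (by omega)
    rw [← Nat.div_add_mod i q, ← Nat.div_add_mod j q, h0, h1]

end Digits

section Homs

/-- An abelian group with many elements and bounded orders contains a large power of a cyclic
group. -/
lemma exists_injective_hom_pi_zmod (M : ℕ) (κ : Type) [Finite κ] [Nonempty κ] :
    ∃ K : ℕ, ∀ (A : Type) [CommGroup A] [Finite A], K < Nat.card A → (∀ a : A, orderOf a < M) →
      ∃ q : ℕ, 1 < q ∧ ∃ Ψ : (κ → Multiplicative (ZMod q)) →* A, Injective Ψ := by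
  classical
  refine ⟨M ^ (M * Nat.card κ), fun A _ _ hA hM ↦ ?_⟩
  obtain ⟨ι, _, n, hn, ⟨φ⟩⟩ := CommGroup.equiv_prod_multiplicative_zmod_of_finite A
  have hnM (i : ι) : n i < M := by
    have := hM (φ.symm (Pi.mulSingle i (Multiplicative.ofAdd 1)))
    rw [MulEquiv.orderOf_eq, ← MonoidHom.mulSingle_apply, orderOf_injective _
      (Pi.mulSingle_injective (M := fun i ↦ Multiplicative (ZMod (n i))) i),
      orderOf_ofAdd_eq_addOrderOf, ZMod.addOrderOf_one] at this
    exact this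
  have hcard : Nat.card A = ∏ i, n i := by
    rw [Nat.card_congr φ.toEquiv, Nat.card_pi]
    exact Finset.prod_congr rfl fun i _ ↦ by
      rw [Nat.card_congr Multiplicative.toAdd, Nat.card_zmod]
  have hι : M * Nat.card κ < Fintype.card ι := by
    by_contra! hle
    have h1 : ∏ i, n i ≤ M ^ Fintype.card ι := by
      rw [← Finset.card_univ]
      exact Finset.prod_le_pow_card _ _ _ fun i _ ↦ (hnM i).le
    have hM0 : 0 < M := (Nat.zero_le _).trans_lt (hM 1)
    have h2 := Nat.pow_le_pow_right hM0 hle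
    omega
  obtain ⟨q, -, hq⟩ := Finset.exists_lt_card_fiber_of_mul_lt_card_of_maps_to
    (s := Finset.univ) (t := Finset.range M) (f := n) (n := Nat.card κ)
    (fun i _ ↦ Finset.mem_range.2 (hnM i)) (by simpa using hι)
  have hqe : Nonempty (κ ↪ {i // n i = q}) := by
    have := Fintype.ofFinite κ
    refine Embedding.nonempty_of_card_le ?_
    rw [Fintype.card_subtype, ← Nat.card_eq_fintype_card]
    exact hq.le
  obtain ⟨σ⟩ := hqe
  have hinv : LeftInverse (invFun σ) σ := leftInverse_invFun σ.injective
  refine ⟨q, ?_, φ.symm.toMonoidHom.comp (MonoidHom.pi fun i ↦ if h : n i = q then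
    (AddMonoidHom.toMultiplicative (ZMod.ringEquivCongr h.symm).toAddMonoidHom).comp
      (Pi.evalMonoidHom _ (invFun σ ⟨i, h⟩)) else 1), ?_⟩
  · obtain ⟨k⟩ := ‹Nonempty κ›
    rw [← (σ k).2]
    exact hn _
  · refine φ.symm.injective.comp fun x y hxy ↦ funext fun k ↦ ?_
    have := congrFun hxy (σ k)
    rw [MonoidHom.pi_apply, MonoidHom.pi_apply, dif_pos (σ k).2] at this
    have h2 : x (invFun σ (σ k)) = y (invFun σ (σ k)) :=
      (ZMod.ringEquivCongr (σ k).2.symm).injective this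
    rwa [hinv k] at h2

/-- Large groups contain many combinatorial analogues of arithmetic progressions. -/
lemma exists_hom_pi_nat (m : ℕ) (ι : Type) [Finite ι] : ∃ n₀ : ℕ, ∀ (Γ : Type) [Group Γ]
    [Finite Γ], n₀ ≤ Nat.card Γ → ∃ (B : Type) (_ : AddCommGroup B)
      (Ψ : Multiplicative (ι → B) →* Γ) (e : ℕ → B), (∀ i j, ∃ l ≤ i + j, e i + e j = e l) ∧
      ∀ I : Set ι, I.Nonempty → ∀ i < m, ∀ j < m,
        Ψ (.ofAdd (I.indicator fun _ ↦ e i)) = Ψ (.ofAdd (I.indicator fun _ ↦ e j)) → i = j := by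
  classical
  have := Fintype.ofFinite ι
  rcases isEmpty_or_nonempty ι with hι | hι
  · exact ⟨0, fun Γ _ _ _ ↦ ⟨Unit, inferInstance, 1, fun _ ↦ (), fun i j ↦ ⟨0, by simp, rfl⟩,
      fun I ⟨t, _⟩ ↦ hι.elim t⟩⟩
  rcases Nat.eq_zero_or_pos m with rfl | hm
  · exact ⟨0, fun Γ _ _ _ ↦ ⟨Unit, inferInstance, 1, fun _ ↦ (), fun i j ↦ ⟨0, by simp, rfl⟩,
      fun I _ i hi ↦ absurd hi (by omega)⟩⟩
  have : Nonempty (Fin m) := ⟨⟨0, hm⟩⟩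
  obtain ⟨K, hK⟩ := exists_injective_hom_pi_zmod (Fintype.card ι * m) (ι × Fin m)
  obtain ⟨n₀, hn₀⟩ := exists_le_card_abelian_subgroup K
  refine ⟨n₀, fun Γ _ _ hΓ ↦ ?_⟩
  by_cases hord : ∃ g : Γ, Fintype.card ι * m ≤ orderOf g
  · obtain ⟨g, hg⟩ := hord
    refine ⟨ℤ, inferInstance, ⟨⟨fun v ↦ g ^ ∑ t, v.toAdd t, by simp⟩, fun v w ↦ ?_⟩,
      fun i ↦ i, fun i j ↦ ⟨i + j, le_rfl, by simp⟩, fun I hI i hi j hj h ↦ ?_⟩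
    · simp [Finset.sum_add_distrib, zpow_add]
    · have hsum (i : ℕ) : ∑ t, I.indicator (fun _ ↦ (i : ℤ)) t = (I.ncard * i : ℕ) := by
        rw [Finset.sum_indicator_eq_sum_filter, Finset.sum_const, Set.filter_mem_univ_eq_toFinset,
          ← Set.ncard_eq_toFinset_card', nsmul_eq_mul, Nat.cast_mul]
      simp only [MonoidHom.coe_mk, OneHom.coe_mk, toAdd_ofAdd, hsum, zpow_natCast] at h
      have hI0 : 0 < I.ncard := (Set.ncard_pos (Set.toFinite I)).2 hI
      have hIle : I.ncard ≤ Fintype.card ι := by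
        rw [← Nat.card_eq_fintype_card]
        exact Set.ncard_le_card I
      have hlt (i : ℕ) (hi : i < m) : I.ncard * i < orderOf g :=
        lt_of_lt_of_le (Nat.mul_lt_mul_of_le_of_lt hIle hi (by omega)) hg
      exact Nat.eq_of_mul_eq_mul_left hI0 (pow_injOn_Iio_orderOf (hlt i hi) (hlt j hj) h)
  · push Not at hord
    obtain ⟨A, hA, hKA⟩ := hn₀ Γ hΓ
    let _ : CommGroup A := { (inferInstance : Group A) with mul_comm := hA.is_comm.comm }
    obtain ⟨q, hq, Ψ, hΨ⟩ := hK A hKA fun a ↦ by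
      rw [← Subgroup.orderOf_coe]
      exact hord a
    have : NeZero q := ⟨by omega⟩
    refine ⟨Fin m → ZMod q, inferInstance, A.subtype.comp (Ψ.comp
      ⟨⟨fun v p ↦ .ofAdd (v.toAdd p.1 p.2), rfl⟩, fun v w ↦ rfl⟩),
      fun i r ↦ (i / q ^ (r : ℕ) : ℕ), fun i j ↦ ?_, fun I ⟨t, ht⟩ i hi j hj h ↦ ?_⟩
    · obtain ⟨l, hl, h⟩ := exists_digitwise_add q m i j
      exact ⟨l, hl, funext fun r ↦ h r r.2⟩
    · have hmq : m < q ^ m := Nat.lt_pow_self hq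
      refine eq_of_digits_eq q m i j (hi.trans hmq) (hj.trans hmq) fun r hr ↦ ?_
      have := congrFun (hΨ (A.subtype_injective h)) (t, ⟨r, hr⟩)
      simpa [ht] using this

end Homs

section Pattern

/-- Dense sets of pairs in a large group contain a product of two translated progression-like
sequences. -/
lemma exists_grid_mem_of_dense (m : ℕ) {c : ℝ} (hc : 0 < c) : ∃ n₀ : ℕ, ∀ (Γ : Type) [Group Γ]
    [Finite Γ], n₀ ≤ Nat.card Γ → ∀ S : Set (Γ × Γ), c ≤ dens S →
      ∃ (f : ℕ → Γ) (x y : Γ), (∀ i j, ∃ l ≤ i + j, f i * f j = f l) ∧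
        (∀ i < m, ∀ j < m, f i = f j → i = j) ∧
        ∀ i < m, ∀ j < m, (x * f i, f j * y) ∈ S := by
  classical
  obtain ⟨ι, _, hι⟩ := densityHalesJewett (Fin m × Fin m) c hc
  obtain ⟨n₀, hn₀⟩ := exists_hom_pi_nat m ι
  refine ⟨n₀, fun Γ _ _ hΓ S hS ↦ ?_⟩
  obtain ⟨B, _, Ψ, e, he, hinj⟩ := hn₀ Γ hΓ
  rcases Nat.eq_zero_or_pos m with rfl | hm
  · refine ⟨1, 1, 1, fun i j ↦ ⟨0, by simp, by simp⟩, by simp, by simp⟩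
  have : Nonempty (Fin m) := ⟨⟨0, hm⟩⟩
  let F (u : ι → Fin m) : Γ := Ψ (.ofAdd fun t ↦ e (u t))
  have havg : c ≤ avg fun p : Γ × Γ ↦
      dens {u : ι → Fin m × Fin m | (p.1 * F fun t ↦ (u t).1, (F fun t ↦ (u t).2) * p.2) ∈ S} := by
    rw [avg_dens_comm fun (p : Γ × Γ) (u : ι → Fin m × Fin m) ↦
      (p.1 * F fun t ↦ (u t).1, (F fun t ↦ (u t).2) * p.2) ∈ S]
    refine le_avg_of_forall fun u ↦ hS.trans (dens_preimage_equiv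
      ((Equiv.mulRight (F fun t ↦ (u t).1)).prodCongr (Equiv.mulLeft (F fun t ↦ (u t).2))) S).ge
  obtain ⟨⟨x, y⟩, hxy⟩ := exists_le_of_le_avg havg
  obtain ⟨l, hl⟩ := hι _ hxy
  let I : Set ι := {t | l.idxFun t = none}
  let v (t : ι) : B := (l.idxFun t).elim 0 fun a ↦ e a.1
  let w (t : ι) : B := (l.idxFun t).elim 0 fun a ↦ e a.2
  let f (i : ℕ) : Γ := Ψ (.ofAdd (I.indicator fun _ ↦ e i))
  refine ⟨f, x * Ψ (.ofAdd v), Ψ (.ofAdd w) * y, fun i j ↦ ?_, hinj I l.proper, ?_⟩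
  · obtain ⟨k, hk, h⟩ := he i j
    refine ⟨k, hk, ?_⟩
    simp only [f]
    rw [← map_mul, ← ofAdd_add, ← indicator_add', ← h]
    rfl
  · intro i hi j hj
    have h1 : (F fun t ↦ (l (⟨i, hi⟩, ⟨j, hj⟩) t).1) = Ψ (.ofAdd v) * f i := by
      simp only [F, f]
      rw [← map_mul, ← ofAdd_add]
      congr 2
      ext t
      rcases h : l.idxFun t with _ | a <;> simp [v, I, h, indicator]
    have h2 : (F fun t ↦ (l (⟨i, hi⟩, ⟨j, hj⟩) t).2) = f j * Ψ (.ofAdd w) := by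
      simp only [F, f]
      rw [← map_mul, ← ofAdd_add]
      congr 2
      ext t
      rcases h : l.idxFun t with _ | a <;> simp [w, I, h, indicator]
    have h3 : (x * F fun t ↦ (l (⟨i, hi⟩, ⟨j, hj⟩) t).1,
      (F fun t ↦ (l (⟨i, hi⟩, ⟨j, hj⟩) t).2) * y) ∈ S := hl (⟨i, hi⟩, ⟨j, hj⟩)
    rwa [h1, h2, ← mul_assoc, mul_assoc (f j)] at h3

lemma exists_card_le_and_card_le_spannedCount {Γ : Type} [Group Γ] [DecidableEq Γ]
    {S : Finset (Γ × Γ)} {m : ℕ} {f : ℕ → Γ} {x y : Γ}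
    (hmul : ∀ i j, ∃ l ≤ i + j, f i * f j = f l) (hinj : ∀ i < m, ∀ j < m, f i = f j → i = j)
    (hS : ∀ i < m, ∀ j < m, (x * f i, f j * y) ∈ S) {a b : ℕ} (ha : a ≤ m) (hb : b ≤ m) (L : ℕ) :
    ∃ T : Finset Γ, T.card ≤ a + b + L ∧
      ((Finset.range a ×ˢ Finset.range b).filter fun p ↦ p.1 + p.2 < L).card ≤
        spannedCount S T := by
  refine ⟨(Finset.range a).image (fun i ↦ x * f i) ∪ (Finset.range b).image (fun j ↦ f j * y) ∪
    (Finset.range L).image (fun l ↦ x * f l * y), ?_, ?_⟩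
  · refine (Finset.card_union_le _ _).trans (add_le_add ((Finset.card_union_le _ _).trans
      (add_le_add ?_ ?_)) ?_) <;> exact Finset.card_image_le.trans (Finset.card_range _).le
  · refine Finset.card_le_card_of_injOn (fun p ↦ (x * f p.1, f p.2 * y)) ?_ ?_
    · rintro ⟨i, j⟩ hij
      obtain ⟨⟨hi, hj⟩, hL⟩ : (i < a ∧ j < b) ∧ i + j < L := by simpa using hij
      obtain ⟨l, hl, h⟩ := hmul i j
      simp only [Finset.coe_filter, mem_ofPred_eq, Finset.mem_union, Finset.mem_image,
        Finset.mem_range]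
      refine ⟨hS i (by omega) j (by omega), .inl (.inl ⟨i, hi, rfl⟩), .inl (.inr ⟨j, hj, rfl⟩),
        .inr ⟨l, by omega, ?_⟩⟩
      rw [← h]
      group
    · rintro ⟨i, j⟩ hij ⟨i', j'⟩ hij' h
      obtain ⟨⟨hi, hj⟩, -⟩ : (i < a ∧ j < b) ∧ i + j < L := by simpa using hij
      obtain ⟨⟨hi', hj'⟩, -⟩ : (i' < a ∧ j' < b) ∧ i' + j' < L := by simpa using hij'
      obtain ⟨h1, h2⟩ : f i = f i' ∧ f j = f j' := by simpa using h
      rw [hinj i (by omega) i' (by omega) h1, hinj j (by omega) j' (by omega) h2]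

lemma exists_nat_grid_parameters (k : ℕ) (hk : 3 ≤ k) : ∃ a ≤ k, ∃ b ≤ k, ∃ L : ℕ,
    ((a + b + L : ℕ) : ℝ) ≤ min ((k : ℝ) + 3) (8 * Real.sqrt k) ∧
      k ≤ ((Finset.range a ×ˢ Finset.range b).filter fun p ↦ p.1 + p.2 < L).card := by
  rcases lt_or_ge k 13 with hk' | hk'
  · have h : ∃ a ≤ k, ∃ b ≤ k, ∃ L ≤ k, a + b + L ≤ k + 3 ∧
        k ≤ ((Finset.range a ×ˢ Finset.range b).filter fun p ↦ p.1 + p.2 < L).card := by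
      interval_cases k
      · exact ⟨2, by decide, 2, by decide, 2, by decide, by decide, by decide⟩
      · exact ⟨2, by decide, 2, by decide, 3, by decide, by decide, by decide⟩
      · exact ⟨3, by decide, 2, by decide, 3, by decide, by decide, by decide⟩
      · exact ⟨3, by decide, 2, by decide, 4, by decide, by decide, by decide⟩
      · exact ⟨3, by decide, 3, by decide, 4, by decide, by decide, by decide⟩
      · exact ⟨3, by decide, 3, by decide, 4, by decide, by decide, by decide⟩
      · exact ⟨3, by decide, 3, by decide, 5, by decide, by decide, by decide⟩
      all_goals exact ⟨3, by decide, 4, by decide, 6, by decide, by decide, by decide⟩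
    obtain ⟨a, ha, b, hb, L, -, h1, h2⟩ := h
    have h3 : ((a + b + L : ℕ) : ℝ) ≤ k + 3 := by exact_mod_cast h1
    refine ⟨a, ha, b, hb, L, le_min h3 (h3.trans ?_), h2⟩
    have h4 : (k : ℝ) < 13 := by exact_mod_cast hk'
    have h5 : (3 : ℝ) ≤ k := by exact_mod_cast hk
    rw [← div_le_iff₀' (by norm_num)]
    refine Real.le_sqrt_of_sq_le ?_
    nlinarith
  · obtain ⟨s, hs⟩ : ∃ s, s = Nat.sqrt (k - 1) := ⟨_, rfl⟩
    have h1 : s * s ≤ k - 1 := hs ▸ Nat.sqrt_le _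
    have h2 : k - 1 < (s + 1) * (s + 1) := hs ▸ Nat.lt_succ_sqrt _
    have h3 : 4 * s + 1 ≤ k := by
      rcases le_or_gt s 3 with h | h
      · omega
      · nlinarith [Nat.mul_le_mul_right s h, Nat.sub_add_cancel (show 1 ≤ k by omega)]
    have h4 : (s : ℝ) ≤ Real.sqrt k := Real.le_sqrt_of_sq_le (by
      rw [sq]
      exact_mod_cast h1.trans (Nat.sub_le _ _))
    have h5 : (1 : ℝ) ≤ Real.sqrt k := Real.one_le_sqrt.2 (by exact_mod_cast (by omega : 1 ≤ k))
    have h6 : (4 * s + 1 : ℝ) ≤ k := by exact_mod_cast h3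
    refine ⟨s + 1, by omega, s + 1, by omega, 2 * s + 1, le_min ?_ ?_, ?_⟩
    · push_cast
      linarith
    · push_cast
      linarith
    · rw [Finset.filter_true_of_mem, Finset.card_product, Finset.card_range]
      · omega
      · simp only [Finset.mem_product, Finset.mem_range]
        omega

end Pattern

end Grids

theorem stmt_0 (k : ℕ) (hk : 3 ≤ k) (c : ℝ) (hc : 0 < c) :
    ∃ n₀ : ℕ, ∀ (Γ : Type) [Group Γ] [Fintype Γ] [DecidableEq Γ],
      n₀ ≤ Fintype.card Γ →
      ∀ S : Finset (Γ × Γ), c * (Fintype.card Γ : ℝ) ^ 2 ≤ (S.card : ℝ) →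
        ∃ T : Finset Γ,
          (T.card : ℝ) ≤ min ((k : ℝ) + 3) (8 * Real.sqrt k) ∧
          k ≤ spannedCount S T := by
  obtain ⟨n₀, hn₀⟩ := exists_grid_mem_of_dense k hc
  refine ⟨n₀, fun Γ _ _ _ hΓ S hS ↦ ?_⟩
  have hcard : (0 : ℝ) < Fintype.card Γ := by exact_mod_cast Fintype.card_pos
  have hdens : c ≤ dens (S : Set (Γ × Γ)) := by
    rw [dens_eq_ncard_div, Set.ncard_coe_finset, Nat.card_eq_fintype_card, Fintype.card_prod,
      Nat.cast_mul, ← sq, le_div_iff₀ (by positivity)]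
    exact hS
  obtain ⟨f, x, y, hmul, hinj, hmem⟩ := hn₀ Γ (by rwa [Nat.card_eq_fintype_card]) S hdens
  obtain ⟨a, ha, b, hb, L, hle, hk⟩ := exists_nat_grid_parameters k hk
  obtain ⟨T, hT, h⟩ := exists_card_le_and_card_le_spannedCount hmul hinj hmem ha hb L
  exact ⟨T, (Nat.cast_le.2 hT).trans hle, hk.trans h⟩
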